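/- Let S′ = (ℤ/2ℤ)[x₁,…,x₁₀]/J′, where J′ is the ideal generated by x₁², x_j² − x_j·x_{j−1} for j = 2,…,8, x₉² − x₉·(x₁+⋯+x₇), and x₁₀²; set y₁ = 0, y_j = x_{j−1} for j = 2,…,8, y₉ = x₁+⋯+x₇, and y₁₀ = 0 in S′, and let w₃ = Σ_{1 ≤ i < j < k ≤ 10} y_i·y_j·y_k. Then w₃² ≠ 0 in S′. -/

import Mathlib

noncomputable section

/-- The generator `xⱼ` (paper-indexed, `j ∈ {1, …, 10}`) of the polynomial ring
`(ℤ/2ℤ)[x₁, …, x₁₀]`. -/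
def Xv (j : ℕ) : MvPolynomial (Fin 10) (ZMod 2) :=
  if h : 1 ≤ j ∧ j ≤ 10 then MvPolynomial.X ⟨j - 1, by omega⟩ else 0

/-- The ideal `J′` of `(ℤ/2ℤ)[x₁, …, x₁₀]` generated by `x₁²`, `xⱼ² − xⱼ·xⱼ₋₁` for
`j = 2, …, 8`, `x₉² − x₉·(x₁ + ⋯ + x₇)`, and `x₁₀²`. -/
def bottIdeal : Ideal (MvPolynomial (Fin 10) (ZMod 2)) :=
  Ideal.span
    ({Xv 1 ^ 2, Xv 9 ^ 2 - Xv 9 * (∑ l ∈ Finset.Icc 1 7, Xv l), Xv 10 ^ 2} ∪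
      {p | ∃ j : ℕ, 2 ≤ j ∧ j ≤ 8 ∧ p = Xv j ^ 2 - Xv j * Xv (j - 1)})

/-- The image of `xⱼ` in the quotient ring `S′ = (ℤ/2ℤ)[x₁, …, x₁₀]/J′`, the mod-2 cohomology
ring of the 10-dimensional real Bott manifold obtained from the 9-dimensional example by
adjoining a zero row and column (i.e. taking the product with a circle). -/
def xq (j : ℕ) : MvPolynomial (Fin 10) (ZMod 2) ⧸ bottIdeal :=
  Ideal.Quotient.mk bottIdeal (Xv j)

/-- The classes `yⱼ` in `S′`: `y₁ = 0`, `yⱼ = xⱼ₋₁` for `j = 2, …, 8`, `y₉ = x₁ + ⋯ + x₇`,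
and `y₁₀ = 0`. -/
def yq (j : ℕ) : MvPolynomial (Fin 10) (ZMod 2) ⧸ bottIdeal :=
  if j = 9 then ∑ l ∈ Finset.Icc 1 7, xq l
  else if 2 ≤ j ∧ j ≤ 8 then xq (j - 1) else 0

/-- A tower of `n` quadratic extensions `xᵢ₊₁² = c i • (xᵢ₊₁ * xᵢ)` starting with `x₀² = 0`,
in which the product of the generators survives. -/
theorem exists_quadratic_tower {k : Type} [Field k] (c : ℕ → k) (n : ℕ) :
    ∃ (R : Type) (_ : CommRing R) (_ : Algebra k R) (x : ℕ → R),
      ∏ i ∈ Finset.range n, x i ≠ 0 ∧ (0 < n → x 0 ^ 2 = 0) ∧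
        ∀ i, i + 1 < n → x (i + 1) ^ 2 = c i • (x (i + 1) * x i) := by
  induction n with
  | zero => exact ⟨k, inferInstance, inferInstance, 0, by simp, by simp, by simp⟩
  | succ n ih =>
    obtain ⟨R, _, _, x, hprod, hzero, hsucc⟩ := ih
    let b : R := if n = 0 then 0 else c (n - 1) • x (n - 1)
    let f : R →ₐ[k] QuadraticAlgebra R 0 b := Algebra.algHom k R _
    have hf (r : R) : f r = QuadraticAlgebra.C r := rfl
    have hω : (QuadraticAlgebra.omega : QuadraticAlgebra R 0 b) ^ 2 =
        QuadraticAlgebra.omega * f b := by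
      ext <;> simp [hf, sq]
    refine ⟨QuadraticAlgebra R 0 b, inferInstance, inferInstance,
      fun i => if i = n then QuadraticAlgebra.omega else f (x i), ?_, fun _ => ?_, fun i hi => ?_⟩
    · rw [Finset.prod_range_succ, if_pos rfl]
      rw [Finset.prod_congr rfl fun i hi => if_neg (Finset.mem_range.mp hi).ne, ← map_prod]
      rw [hf]
      intro h
      have him := congrArg QuadraticAlgebra.im h
      rw [QuadraticAlgebra.im_mul] at him
      exact hprod (by simpa only [QuadraticAlgebra.re_C, QuadraticAlgebra.im_C,
        QuadraticAlgebra.omega_re, QuadraticAlgebra.omega_im, QuadraticAlgebra.im_zero,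
        mul_one, mul_zero, zero_mul, add_zero] using him)
    · rcases Nat.eq_zero_or_pos n with rfl | hn
      · simp [hω, b]
      · beta_reduce
        rw [if_neg hn.ne, ← map_pow, hzero hn, map_zero]
    · rcases (Nat.lt_succ_iff.mp hi).eq_or_lt with rfl | hi
      · have hb : f b = c i • f (x i) := map_smul f (c i) (x i)
        simp only [if_pos, hω, i.succ_ne_self.symm, if_false, hb, mul_smul_comm]
      · beta_reduce
        rw [if_neg hi.ne, if_neg (by omega), ← map_pow, hsucc i hi, map_smul, map_mul]

/-- Evaluation of the third elementary symmetric polynomial in the classes `yⱼ` after `x₅`, `x₈`,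
`x₉`, `x₁₀` are sent to zero. -/
theorem sq_esymm_three_eq_prod {R : Type*} [CommRing R] [CharP R 2] {a b c d e f : R}
    (ha : a ^ 2 = 0) (hb : b ^ 2 = b * a) (hc : c ^ 2 = c * b) (hd : d ^ 2 = d * c)
    (he : e ^ 2 = 0) (hf : f ^ 2 = f * e) (y : ℕ → R)
    (h1 : y 1 = 0) (h2 : y 2 = a) (h3 : y 3 = b) (h4 : y 4 = c) (h5 : y 5 = d) (h6 : y 6 = 0)
    (h7 : y 7 = e) (h8 : y 8 = f) (h9 : y 9 = a + b + c + d + e + f) (h10 : y 10 = 0) :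
    (∑ i ∈ Finset.Icc 1 10, ∑ j ∈ Finset.Icc (i + 1) 10, ∑ k ∈ Finset.Icc (j + 1) 10,
      y i * y j * y k) ^ 2 = a * b * c * d * e * f := by
  have h : ∑ i ∈ Finset.Icc 1 10, ∑ j ∈ Finset.Icc (i + 1) 10, ∑ k ∈ Finset.Icc (j + 1) 10,
      y i * y j * y k =
        a ^ 2 * (b + c + d + e + f) + b ^ 2 * (a + c + d + e + f) +
        c ^ 2 * (a + b + d + e + f) + d ^ 2 * (a + b + c + e + f) +
        e ^ 2 * (a + b + c + d + f) + f ^ 2 * (a + b + c + d + e) := by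
    simp [Finset.sum_Icc_succ_top, h1, h2, h3, h4, h5, h6, h7, h8, h9, h10]
    grind
  have ha4 : a ^ 4 = 0 := by grind
  have hb4 : b ^ 4 = 0 := by grind
  have hc4 : c ^ 4 = 0 := by grind
  have hd4 : d ^ 4 = a * b * c * d := by grind
  have he4 : e ^ 4 = 0 := by grind
  have hf4 : f ^ 4 = 0 := by grind
  rw [h]
  simp only [CharTwo.add_sq, mul_pow, ← pow_mul, Nat.reduceMul, ha4, hb4, hc4, hd4, he4, hf4]
  grind

/-- In the ring `S′ = (ℤ/2ℤ)[x₁,…,x₁₀]/J′`, with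
`w₃ = Σ_{1 ≤ i < j < k ≤ 10} yᵢ·yⱼ·y_k` (the third Stiefel–Whitney class of the
10-dimensional real Bott manifold above), one has `w₃² ≠ 0`. -/
theorem stmt16 :
    (∑ i ∈ Finset.Icc 1 10, ∑ j ∈ Finset.Icc (i + 1) 10, ∑ k ∈ Finset.Icc (j + 1) 10,
        yq i * yq j * yq k) ^ 2 ≠ 0 := by
  obtain ⟨R, _, _, x, hprod, hzero, hsucc⟩ :=
    exists_quadratic_tower (fun i => if i = 3 then (0 : ZMod 2) else 1) 6
  have : Nontrivial R := ⟨_, _, hprod⟩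
  have : CharP R 2 := charP_of_injective_algebraMap (algebraMap (ZMod 2) R).injective 2
  replace hzero := hzero (by norm_num)
  have hx1 := hsucc 0 (by norm_num)
  have hx2 := hsucc 1 (by norm_num)
  have hx3 := hsucc 2 (by norm_num)
  have hx4 := hsucc 3 (by norm_num)
  have hx5 := hsucc 4 (by norm_num)
  norm_num at hx1 hx2 hx3 hx4 hx5
  let v : Fin 10 → R := ![x 0, x 1, x 2, x 3, 0, x 4, x 5, 0, 0, 0]
  let ev : MvPolynomial (Fin 10) (ZMod 2) →+* R := (MvPolynomial.aeval v).toRingHom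
  have hev (j : ℕ) : ev (Xv j) = if h : 1 ≤ j ∧ j ≤ 10 then v ⟨j - 1, by omega⟩ else 0 := by
    unfold Xv
    split_ifs <;> simp [ev]
  have hker : ∀ p ∈ bottIdeal, ev p = 0 := by
    suffices bottIdeal ≤ RingHom.ker ev from this
    refine Ideal.span_le.mpr ?_
    rintro p ((rfl | rfl | rfl) | ⟨j, hj, hj', rfl⟩)
    · simp [hev, v, hzero]
    · simp [hev, v]
    · simp [hev, v]
    · interval_cases j <;> simp [hev, v, hx1, hx2, hx3, hx4, hx5]
  let φ := Ideal.Quotient.lift bottIdeal ev hker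
  have hφ (j : ℕ) : φ (xq j) = ev (Xv j) := Ideal.Quotient.lift_mk ..
  intro h
  apply hprod
  have key := sq_esymm_three_eq_prod hzero hx1 hx2 hx3 hx4 hx5 (fun j => φ (yq j))
    (by simp [yq]) (by simp [yq, hφ, hev, v]) (by simp [yq, hφ, hev, v])
    (by simp [yq, hφ, hev, v]) (by simp [yq, hφ, hev, v]) (by simp [yq, hφ, hev, v])
    (by simp [yq, hφ, hev, v]) (by simp [yq, hφ, hev, v])
    (by simp [yq, hφ, hev, v, Finset.sum_Icc_succ_top]) (by simp [yq])
  simp only [← map_mul, ← map_sum, ← map_pow, h, map_zero] at key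
  simp [Finset.prod_range_succ, ← key]

end
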